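/- Let (H, α) be a monoidal Hom-Hopf T-coalgebra over G with bijective antipode, (M, μ) ∈ YD_p and (N, ν) ∈ YD_q. Define c_{M,N}: M ⊗ N → ^MN ⊗ M by c_{M,N}(m ⊗ n) = ^p(S_{q^{-1}}(m_{(1,q^{-1})})·ν^{-1}(n)) ⊗ μ(m_{(0)}) and d: ^MN ⊗ M → M ⊗ N by d(^pn ⊗ m) = μ(m_{(0)}) ⊗ m_{(1,q)}·ν^{-1}(n). Then d ∘ c_{M,N} = id_{M⊗N} and c_{M,N} ∘ d = id_{^MN ⊗ M}; in particular the braiding c_{M,N} is bijective with inverse c_{M,N}^{-1} = d. -/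

import Mathlib

open TensorProduct

noncomputable section

section Cast

variable (k : Type*) [Field k] {G : Type*} [Group G] {H : G → Type*}
  [∀ p, AddCommGroup (H p)] [∀ p, Module k (H p)]

/-- Transport of components along an equality of group elements. -/
def cst {a b : G} (h : a = b) : H a →ₗ[k] H b := by subst h; exact LinearMap.id

/-- Transport of components along an equality of group elements, as a linear equivalence. -/
def cstE {a b : G} (h : a = b) : H a ≃ₗ[k] H b := by subst h; exact LinearEquiv.refl k (H a)

end Cast

/-- A (classical) Hopf group-coalgebra over a group `G`. -/
structure HopfGC (k : Type*) [Field k] (G : Type*) [Group G] (H : G → Type*)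
    [∀ p, AddCommGroup (H p)] [∀ p, Module k (H p)] where
  mul : ∀ p : G, H p →ₗ[k] H p →ₗ[k] H p
  one : ∀ p : G, H p
  comul : ∀ p q : G, H (p * q) →ₗ[k] H p ⊗[k] H q
  counit : H (1 : G) →ₗ[k] k
  antipode : ∀ p : G, H p →ₗ[k] H p⁻¹
  mul_assoc' : ∀ (p : G) (a b c : H p), mul p (mul p a b) c = mul p a (mul p b c)
  one_mul' : ∀ (p : G) (a : H p), mul p (one p) a = a
  mul_one' : ∀ (p : G) (a : H p), mul p a (one p) = a
  coassoc : ∀ p q r : G,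
    (TensorProduct.assoc k (H p) (H q) (H r)).toLinearMap.comp
      ((TensorProduct.map (comul p q) LinearMap.id).comp (comul (p * q) r))
    = (TensorProduct.map LinearMap.id (comul q r)).comp
        ((comul p (q * r)).comp (cst k (mul_assoc p q r)))
  counit_comul' : ∀ (p : G) (c : H p),
    (TensorProduct.lid k (H p))
      ((TensorProduct.map counit LinearMap.id) (comul 1 p (cst k (one_mul p).symm c))) = c
  comul_counit' : ∀ (p : G) (c : H p),
    (TensorProduct.rid k (H p))
      ((TensorProduct.map LinearMap.id counit) (comul p 1 (cst k (mul_one p).symm c))) = c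
  comul_mul : ∀ (p q : G) (a b : H (p * q)),
    comul p q (mul (p * q) a b)
      = TensorProduct.map₂ (mul p) (mul q) (comul p q a) (comul p q b)
  comul_one : ∀ p q : G, comul p q (one (p * q)) = (one p) ⊗ₜ[k] (one q)
  counit_mul : ∀ a b : H (1 : G), counit (mul 1 a b) = counit a * counit b
  counit_one : counit (one 1) = 1
  antipode_left : ∀ (p : G) (h : H (1 : G)),
    TensorProduct.lift (mul p)
      ((TensorProduct.map ((cst k (inv_inv p)).comp (antipode p⁻¹)) LinearMap.id)
        (comul p⁻¹ p (cst k (show (1 : G) = p⁻¹ * p by group) h)))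
    = counit h • one p
  antipode_right : ∀ (p : G) (h : H (1 : G)),
    TensorProduct.lift (mul p)
      ((TensorProduct.map LinearMap.id ((cst k (inv_inv p)).comp (antipode p⁻¹)))
        (comul p p⁻¹ (cst k (show (1 : G) = p * p⁻¹ by group) h)))
    = counit h • one p

/-- An automorphism of a Hopf group-coalgebra. -/
structure HopfGCAut {k : Type*} [Field k] {G : Type*} [Group G] {H : G → Type*}
    [∀ p, AddCommGroup (H p)] [∀ p, Module k (H p)] (D : HopfGC k G H) where
  α : ∀ p : G, H p ≃ₗ[k] H p
  map_mul : ∀ (p : G) (a b : H p), α p (D.mul p a b) = D.mul p (α p a) (α p b)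
  map_one : ∀ p : G, α p (D.one p) = D.one p
  map_comul : ∀ (p q : G) (c : H (p * q)),
    TensorProduct.map (α p).toLinearMap (α q).toLinearMap (D.comul p q c)
      = D.comul p q (α (p * q) c)
  map_counit : ∀ c : H (1 : G), D.counit (α 1 c) = D.counit c
  map_antipode : ∀ (p : G) (h : H p), D.antipode p (α p h) = α p⁻¹ (D.antipode p h)

/-- The axioms of a group-cograded monoidal Hom-Hopf algebra, for given structure data. -/
structure IsGCHH (k : Type*) [Field k] {G : Type*} [Group G] {H : G → Type*}
    [∀ p, AddCommGroup (H p)] [∀ p, Module k (H p)]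
    (mul : ∀ p : G, H p →ₗ[k] H p →ₗ[k] H p) (one : ∀ p : G, H p)
    (comul : ∀ p q : G, H (p * q) →ₗ[k] H p ⊗[k] H q) (counit : H (1 : G) →ₗ[k] k)
    (antipode : ∀ p : G, H p →ₗ[k] H p⁻¹) (α : ∀ p : G, H p ≃ₗ[k] H p) : Prop where
  hom_assoc : ∀ (p : G) (a b c : H p), mul p (α p a) (mul p b c) = mul p (mul p a b) (α p c)
  one_mul' : ∀ (p : G) (a : H p), mul p (one p) a = α p a
  mul_one' : ∀ (p : G) (a : H p), mul p a (one p) = α p a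
  α_mul : ∀ (p : G) (a b : H p), α p (mul p a b) = mul p (α p a) (α p b)
  α_one : ∀ p : G, α p (one p) = one p
  hcoassoc : ∀ p q r : G,
    (TensorProduct.map (α p).symm.toLinearMap (comul q r)).comp
      ((comul p (q * r)).comp (cst k (mul_assoc p q r)))
    = (TensorProduct.assoc k (H p) (H q) (H r)).toLinearMap.comp
        ((TensorProduct.map (comul p q) (α r).symm.toLinearMap).comp (comul (p * q) r))
  counit_comul' : ∀ (p : G) (c : H p),
    (TensorProduct.lid k (H p))
      ((TensorProduct.map counit LinearMap.id) (comul 1 p (cst k (one_mul p).symm c)))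
    = (α p).symm c
  comul_counit' : ∀ (p : G) (c : H p),
    (TensorProduct.rid k (H p))
      ((TensorProduct.map LinearMap.id counit) (comul p 1 (cst k (mul_one p).symm c)))
    = (α p).symm c
  comul_αinv : ∀ (p q : G) (c : H (p * q)),
    comul p q ((α (p * q)).symm c)
      = TensorProduct.map (α p).symm.toLinearMap (α q).symm.toLinearMap (comul p q c)
  counit_αinv : ∀ c : H (1 : G), counit ((α 1).symm c) = counit c
  comul_mul : ∀ (p q : G) (a b : H (p * q)),
    comul p q (mul (p * q) a b)
      = TensorProduct.map₂ (mul p) (mul q) (comul p q a) (comul p q b)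
  comul_one : ∀ p q : G, comul p q (one (p * q)) = (one p) ⊗ₜ[k] (one q)
  counit_mul : ∀ a b : H (1 : G), counit (mul 1 a b) = counit a * counit b
  counit_one : counit (one 1) = 1
  antipode_α : ∀ (p : G) (h : H p), antipode p (α p h) = (α p⁻¹) (antipode p h)
  antipode_left : ∀ (p : G) (h : H (1 : G)),
    TensorProduct.lift (mul p)
      ((TensorProduct.map ((cst k (inv_inv p)).comp (antipode p⁻¹)) LinearMap.id)
        (comul p⁻¹ p (cst k (show (1 : G) = p⁻¹ * p by group) h)))
    = counit h • one p
  antipode_right : ∀ (p : G) (h : H (1 : G)),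
    TensorProduct.lift (mul p)
      ((TensorProduct.map LinearMap.id ((cst k (inv_inv p)).comp (antipode p⁻¹)))
        (comul p p⁻¹ (cst k (show (1 : G) = p * p⁻¹ by group) h)))
    = counit h • one p

/-- The axioms of a crossing on a group-cograded (monoidal Hom-)Hopf algebra. -/
structure IsCrossing (k : Type*) [Field k] {G : Type*} [Group G] {H : G → Type*}
    [∀ p, AddCommGroup (H p)] [∀ p, Module k (H p)]
    (mul : ∀ p : G, H p →ₗ[k] H p →ₗ[k] H p) (one : ∀ p : G, H p)
    (comul : ∀ p q : G, H (p * q) →ₗ[k] H p ⊗[k] H q) (counit : H (1 : G) →ₗ[k] k)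
    (α : ∀ p : G, H p ≃ₗ[k] H p)
    (π : ∀ q p : G, H p ≃ₗ[k] H (q * p * q⁻¹)) : Prop where
  π_mul : ∀ (q p : G) (a b : H p),
    π q p (mul p a b) = mul (q * p * q⁻¹) (π q p a) (π q p b)
  π_one : ∀ q p : G, π q p (one p) = one (q * p * q⁻¹)
  π_α : ∀ (q p : G) (a : H p), π q p (α p a) = α (q * p * q⁻¹) (π q p a)
  π_comul : ∀ (q a b : G) (c : H (a * b)),
    TensorProduct.map (π q a).toLinearMap (π q b).toLinearMap (comul a b c)
      = comul (q * a * q⁻¹) (q * b * q⁻¹)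
          (cst k (show q * (a * b) * q⁻¹ = (q * a * q⁻¹) * (q * b * q⁻¹) by group) (π q (a * b) c))
  π_counit : ∀ (q : G) (c : H (1 : G)),
    counit (cst k (show q * (1 : G) * q⁻¹ = 1 by group) (π q 1 c)) = counit c
  π_mult : ∀ (a b p : G) (c : H p),
    cst k (show (a * b) * p * (a * b)⁻¹ = a * (b * p * b⁻¹) * a⁻¹ by group) (π (a * b) p c)
      = π a (b * p * b⁻¹) (π b p c)

/-- A (classical) Hopf `T`-coalgebra: a Hopf group-coalgebra with a crossing. -/
structure HopfTC (k : Type*) [Field k] (G : Type*) [Group G] (H : G → Type*)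
    [∀ p, AddCommGroup (H p)] [∀ p, Module k (H p)] extends HopfGC k G H where
  π : ∀ q p : G, H p ≃ₗ[k] H (q * p * q⁻¹)
  π_mul : ∀ (q p : G) (a b : H p),
    π q p (mul p a b) = mul (q * p * q⁻¹) (π q p a) (π q p b)
  π_one : ∀ q p : G, π q p (one p) = one (q * p * q⁻¹)
  π_comul : ∀ (q a b : G) (c : H (a * b)),
    TensorProduct.map (π q a).toLinearMap (π q b).toLinearMap (comul a b c)
      = comul (q * a * q⁻¹) (q * b * q⁻¹)
          (cst k (show q * (a * b) * q⁻¹ = (q * a * q⁻¹) * (q * b * q⁻¹) by group) (π q (a * b) c))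
  π_counit : ∀ (q : G) (c : H (1 : G)),
    counit (cst k (show q * (1 : G) * q⁻¹ = 1 by group) (π q 1 c)) = counit c
  π_antipode : ∀ (q p : G) (h : H p),
    antipode (q * p * q⁻¹) (π q p h)
      = cst k (show q * p⁻¹ * q⁻¹ = (q * p * q⁻¹)⁻¹ by group) (π q p⁻¹ (antipode p h))
  π_mult : ∀ (a b p : G) (c : H p),
    cst k (show (a * b) * p * (a * b)⁻¹ = a * (b * p * b⁻¹) * a⁻¹ by group) (π (a * b) p c)
      = π a (b * p * b⁻¹) (π b p c)

/-- A group-cograded monoidal Hom-Hopf algebra (bundled data). -/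
structure GCHH (k : Type*) [Field k] (G : Type*) [Group G] (H : G → Type*)
    [∀ p, AddCommGroup (H p)] [∀ p, Module k (H p)] where
  mul : ∀ p : G, H p →ₗ[k] H p →ₗ[k] H p
  one : ∀ p : G, H p
  comul : ∀ p q : G, H (p * q) →ₗ[k] H p ⊗[k] H q
  counit : H (1 : G) →ₗ[k] k
  antipode : ∀ p : G, H p →ₗ[k] H p⁻¹
  α : ∀ p : G, H p ≃ₗ[k] H p
  ax : IsGCHH k mul one comul counit antipode α

/-- A monoidal Hom-Hopf `T`-coalgebra with bijective antipode (bundled data). -/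
structure HomTC (k : Type*) [Field k] (G : Type*) [Group G] (H : G → Type*)
    [∀ p, AddCommGroup (H p)] [∀ p, Module k (H p)] where
  mul : ∀ p : G, H p →ₗ[k] H p →ₗ[k] H p
  one : ∀ p : G, H p
  comul : ∀ p q : G, H (p * q) →ₗ[k] H p ⊗[k] H q
  counit : H (1 : G) →ₗ[k] k
  antipode : ∀ p : G, H p ≃ₗ[k] H p⁻¹
  α : ∀ p : G, H p ≃ₗ[k] H p
  π : ∀ q p : G, H p ≃ₗ[k] H (q * p * q⁻¹)
  ax : IsGCHH k mul one comul counit (fun p => (antipode p).toLinearMap) α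
  cax : IsCrossing k mul one comul counit α π

section YD

variable {k : Type*} [Field k] {G : Type*} [Group G] {H : G → Type*}
  [∀ p, AddCommGroup (H p)] [∀ p, Module k (H p)]

variable (k)

/-- The Yetter-Drinfeld compatibility condition (3) of Definition 4.1. -/
def YDcompat (T : HomTC k G H) (p : G) {M : Type*} [AddCommGroup M] [Module k M]
    (μ : M ≃ₗ[k] M) (act : H p →ₗ[k] M →ₗ[k] M)
    (ρ : ∀ r : G, M →ₗ[k] M ⊗[k] H r) : Prop :=
  ∀ r : G,
    (TensorProduct.map (TensorProduct.lift act) (TensorProduct.lift (T.mul r))).comp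
      ((TensorProduct.tensorTensorTensorComm k (H p) (H r) M (H r)).toLinearMap.comp
        (TensorProduct.map (T.comul p r) (ρ r)))
    =
    (TensorProduct.map μ.toLinearMap (TensorProduct.lift (T.mul r))).comp
      ((TensorProduct.assoc k M (H r) (H r)).toLinearMap.comp
        (((TensorProduct.comm k (H r) (M ⊗[k] H r)).toLinearMap).comp
          ((TensorProduct.map
              ((cst k (show p⁻¹ * (p * r * p⁻¹) * p⁻¹⁻¹ = r by group)).comp
                (T.π p⁻¹ (p * r * p⁻¹)).toLinearMap)
              ((ρ r).comp (TensorProduct.lift act))).comp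
            ((TensorProduct.assoc k (H (p * r * p⁻¹)) (H p) M).toLinearMap.comp
              (TensorProduct.map
                ((T.comul (p * r * p⁻¹) p).comp
                  (cst k (show p * r = (p * r * p⁻¹) * p by group)))
                μ.symm.toLinearMap)))))

/-- The axioms of a (left-right) `p`-Yetter-Drinfeld module over a monoidal Hom-Hopf
`T`-coalgebra. -/
structure IsYD (T : HomTC k G H) (p : G) {M : Type*} [AddCommGroup M] [Module k M]
    (μ : M ≃ₗ[k] M) (act : H p →ₗ[k] M →ₗ[k] M)
    (ρ : ∀ r : G, M →ₗ[k] M ⊗[k] H r) : Prop where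
  act_act : ∀ (a b : H p) (m : M), act (T.α p a) (act b m) = act (T.mul p a b) (μ m)
  act_one : ∀ m : M, act (T.one p) m = μ m
  μ_act : ∀ (a : H p) (m : M), μ (act a m) = act (T.α p a) (μ m)
  ρ_coassoc : ∀ a b : G,
    (TensorProduct.map μ.symm.toLinearMap (T.comul a b)).comp (ρ (a * b))
    = (TensorProduct.assoc k M (H a) (H b)).toLinearMap.comp
        ((TensorProduct.map (ρ a) (T.α b).symm.toLinearMap).comp (ρ b))
  ρ_counit : ∀ m : M,
    (TensorProduct.rid k M) ((TensorProduct.map LinearMap.id T.counit) (ρ 1 m)) = μ.symm m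
  ρ_μ : ∀ r : G,
    (ρ r).comp μ.toLinearMap
      = (TensorProduct.map μ.toLinearMap (T.α r).toLinearMap).comp (ρ r)
  compat : YDcompat k T p μ act ρ

/-- The action of `H (a*b)` on a tensor product of an `H a`-module and an `H b`-module. -/
def tAct (T : HomTC k G H) (a b : G) {M N : Type*} [AddCommGroup M] [Module k M]
    [AddCommGroup N] [Module k N]
    (actM : H a →ₗ[k] M →ₗ[k] M) (actN : H b →ₗ[k] N →ₗ[k] N) :
    H (a * b) →ₗ[k] (M ⊗[k] N) →ₗ[k] (M ⊗[k] N) :=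
  (TensorProduct.map₂ actM actN).comp (T.comul a b)

/-- The coaction on the tensor product `M ⊗ N`, where `N` has degree `b`:
`ρ r (m ⊗ n) = m₍₀₎ ⊗ n₍₀₎ ⊗ n₍₁,r₎ ⬝ π_{b⁻¹}(m₍₁,brb⁻¹₎)`. -/
def tCoact (T : HomTC k G H) (b : G) {M N : Type*} [AddCommGroup M] [Module k M]
    [AddCommGroup N] [Module k N]
    (ρM : ∀ r : G, M →ₗ[k] M ⊗[k] H r) (ρN : ∀ r : G, N →ₗ[k] N ⊗[k] H r) (r : G) :
    (M ⊗[k] N) →ₗ[k] (M ⊗[k] N) ⊗[k] H r :=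
  (TensorProduct.map LinearMap.id
      (TensorProduct.lift (((T.mul r).flip).comp
        ((cst k (show b⁻¹ * (b * r * b⁻¹) * b⁻¹⁻¹ = r by group)).comp
          (T.π b⁻¹ (b * r * b⁻¹)).toLinearMap)))).comp
    ((TensorProduct.tensorTensorTensorComm k M (H (b * r * b⁻¹)) N (H r)).toLinearMap.comp
      (TensorProduct.map (ρM (b * r * b⁻¹)) (ρN r)))

/-- The conjugate action on `ᵠM`: `h ⇀ m = π_{s⁻¹}(h) ⬝ m`. -/
def cAct (T : HomTC k G H) (s p : G) {M : Type*} [AddCommGroup M] [Module k M]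
    (act : H p →ₗ[k] M →ₗ[k] M) : H (s * p * s⁻¹) →ₗ[k] M →ₗ[k] M :=
  act.comp ((cst k (show s⁻¹ * (s * p * s⁻¹) * s⁻¹⁻¹ = p by group)).comp
    (T.π s⁻¹ (s * p * s⁻¹)).toLinearMap)

/-- The conjugate coaction on `ˢM`: `ρ r m = m₍₀₎ ⊗ π_s (m₍₁,s⁻¹rs₎)`. -/
def cCoact (T : HomTC k G H) (s : G) {M : Type*} [AddCommGroup M] [Module k M]
    (ρ : ∀ r : G, M →ₗ[k] M ⊗[k] H r) (r : G) : M →ₗ[k] M ⊗[k] H r :=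
  (TensorProduct.map LinearMap.id
      ((cst k (show s * (s⁻¹ * r * s) * s⁻¹ = r by group)).comp
        (T.π s (s⁻¹ * r * s)).toLinearMap)).comp
    (ρ (s⁻¹ * r * s))

/-- The Hom-associator `(A ⊗ B) ⊗ C ≃ A ⊗ (B ⊗ C)`, `(a ⊗ b) ⊗ c ↦ φA a ⊗ (b ⊗ φC⁻¹ c)`. -/
def homAssoc {A B C : Type*} [AddCommGroup A] [Module k A] [AddCommGroup B] [Module k B]
    [AddCommGroup C] [Module k C] (φA : A ≃ₗ[k] A) (φC : C ≃ₗ[k] C) :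
    (A ⊗[k] B) ⊗[k] C ≃ₗ[k] A ⊗[k] (B ⊗[k] C) :=
  (TensorProduct.assoc k A B C).trans
    (TensorProduct.congr φA (TensorProduct.congr (LinearEquiv.refl k B) φC.symm))

/-- The braiding `c_{M,W} : M ⊗ W → ᴹW ⊗ M`,
`m ⊗ w ↦ (S_{w⁻¹}(m₍₁,w⁻¹₎) ⬝ φW⁻¹ w) ⊗ μ m₍₀₎`, where `W` has degree `w`. -/
def braid (T : HomTC k G H) (w : G) {M W : Type*} [AddCommGroup M] [Module k M]
    [AddCommGroup W] [Module k W] (μ : M ≃ₗ[k] M) (ρM : ∀ r : G, M →ₗ[k] M ⊗[k] H r)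
    (actW : H w →ₗ[k] W →ₗ[k] W) (φW : W ≃ₗ[k] W) : (M ⊗[k] W) →ₗ[k] (W ⊗[k] M) :=
  (TensorProduct.comm k M W).toLinearMap.comp
    ((TensorProduct.map μ.toLinearMap
        (TensorProduct.lift (actW.comp
          ((cst k (inv_inv w)).comp (T.antipode w⁻¹).toLinearMap)))).comp
      ((TensorProduct.assoc k M (H w⁻¹) W).toLinearMap.comp
        (TensorProduct.map (ρM w⁻¹) φW.symm.toLinearMap)))

end YD

/-- The axioms of a monoidal Hom-Hopf algebra on a single space. -/
structure IsMonHomHopf (k : Type*) [Field k] (A : Type*) [AddCommGroup A] [Module k A]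
    (mul : A →ₗ[k] A →ₗ[k] A) (one : A) (comul : A →ₗ[k] A ⊗[k] A) (counit : A →ₗ[k] k)
    (S : A →ₗ[k] A) (α : A ≃ₗ[k] A) : Prop where
  hom_assoc : ∀ a b c : A, mul (α a) (mul b c) = mul (mul a b) (α c)
  one_mul' : ∀ a : A, mul one a = α a
  mul_one' : ∀ a : A, mul a one = α a
  α_mul : ∀ a b : A, α (mul a b) = mul (α a) (α b)
  α_one : α one = one
  hcoassoc :
    (TensorProduct.map α.symm.toLinearMap comul).comp comul
    = (TensorProduct.assoc k A A A).toLinearMap.comp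
        ((TensorProduct.map comul α.symm.toLinearMap).comp comul)
  counit_comul' : ∀ a : A,
    (TensorProduct.lid k A) ((TensorProduct.map counit LinearMap.id) (comul a)) = α.symm a
  comul_counit' : ∀ a : A,
    (TensorProduct.rid k A) ((TensorProduct.map LinearMap.id counit) (comul a)) = α.symm a
  comul_αinv : ∀ a : A,
    comul (α.symm a) = TensorProduct.map α.symm.toLinearMap α.symm.toLinearMap (comul a)
  counit_αinv : ∀ a : A, counit (α.symm a) = counit a
  comul_mul : ∀ a b : A, comul (mul a b) = TensorProduct.map₂ mul mul (comul a) (comul b)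
  comul_one : comul one = one ⊗ₜ[k] one
  counit_mul : ∀ a b : A, counit (mul a b) = counit a * counit b
  counit_one : counit one = 1
  antipode_α : ∀ a : A, S (α a) = α (S a)
  antipode_left : ∀ a : A,
    TensorProduct.lift mul ((TensorProduct.map S LinearMap.id) (comul a)) = counit a • one
  antipode_right : ∀ a : A,
    TensorProduct.lift mul ((TensorProduct.map LinearMap.id S) (comul a)) = counit a • one

variable {k : Type*} [Field k] {G : Type*} [Group G] {H : G → Type*}
  [∀ p, AddCommGroup (H p)] [∀ p, Module k (H p)]

variable (k) in
/-- The candidate inverse of the braiding: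
`d(ⁿ ⊗ m) = μ m₍₀₎ ⊗ m₍₁,q₎ ⬝ ν⁻¹ n`. -/
def braidInv (T : HomTC k G H) (q : G) {M N : Type*} [AddCommGroup M] [Module k M]
    [AddCommGroup N] [Module k N] (μ : M ≃ₗ[k] M) (ρM : ∀ r : G, M →ₗ[k] M ⊗[k] H r)
    (actN : H q →ₗ[k] N →ₗ[k] N) (ν : N ≃ₗ[k] N) : (N ⊗[k] M) →ₗ[k] M ⊗[k] N :=
  (TensorProduct.map μ.toLinearMap (TensorProduct.lift actN)).comp
    ((TensorProduct.assoc k M (H q) N).toLinearMap.comp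
      ((TensorProduct.map (ρM q) ν.symm.toLinearMap).comp
        (TensorProduct.comm k N M).toLinearMap))

section TwistedAction

variable {M : Type*} [AddCommGroup M] [Module k M] {N : Type*} [AddCommGroup N] [Module k N]

omit [Group G] in
@[simp] lemma cst_rfl {a : G} (h : a = a) : (cst k h : H a →ₗ[k] H a) = LinearMap.id := rfl

omit [Group G] in
lemma cst_comm_family (φ : ∀ p : G, H p ≃ₗ[k] H p) {a b : G} (h : a = b) (x : H a) :
    cst k h (φ a x) = φ b (cst k h x) := by
  subst h; rfl

omit [Group G] in
lemma coaction_cst (ρ : ∀ r : G, M →ₗ[k] M ⊗[k] H r) {a b : G} (h : a = b) (m : M) :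
    ρ b m = TensorProduct.map LinearMap.id (cst k h) (ρ a m) := by
  subst h; simp

/-- The endomorphism `m ⊗ n ↦ μ m₍₀₎ ⊗ f(m₍₁,a₎) ⬝ ν⁻¹ n` of `M ⊗ N`. -/
def twistedAction {q a : G} (μ : M ≃ₗ[k] M) (ρ : ∀ r : G, M →ₗ[k] M ⊗[k] H r)
    (act : H q →ₗ[k] N →ₗ[k] N) (ν : N ≃ₗ[k] N) (f : H a →ₗ[k] H q) :
    (M ⊗[k] N) →ₗ[k] (M ⊗[k] N) :=
  (TensorProduct.map μ.toLinearMap (TensorProduct.lift (act.comp f))).comp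
    ((TensorProduct.assoc k M (H a) N).toLinearMap.comp
      (TensorProduct.map (ρ a) ν.symm.toLinearMap))

/-- Twisted actions along convolution-inverse maps are inverse to each other. -/
lemma twistedAction_comp (T : HomTC k G H) {p q a b : G} (hab : (1 : G) = a * b)
    {μ : M ≃ₗ[k] M} {actM : H p →ₗ[k] M →ₗ[k] M} {ρM : ∀ r : G, M →ₗ[k] M ⊗[k] H r}
    {ν : N ≃ₗ[k] N} {actN : H q →ₗ[k] N →ₗ[k] N} {ρN : ∀ r : G, N →ₗ[k] N ⊗[k] H r}
    (hM : IsYD k T p μ actM ρM) (hN : IsYD k T q ν actN ρN)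
    (f : H a →ₗ[k] H q) (g : H b →ₗ[k] H q)
    (hf : ∀ x, f (T.α a x) = T.α q (f x)) (hg : ∀ x, g (T.α b x) = T.α q (g x))
    (hfg : ∀ h : H (1 : G), TensorProduct.lift (T.mul q)
      (TensorProduct.map f g (T.comul a b (cst k hab h))) = T.counit h • T.one q) :
    (twistedAction μ ρM actN ν f).comp (twistedAction μ ρM actN ν g) = LinearMap.id := by
  refine TensorProduct.ext' fun m n => ?_
  let B : M ⊗[k] (H a ⊗[k] H b) →ₗ[k] M ⊗[k] N :=
    TensorProduct.map (μ.toLinearMap.comp μ.toLinearMap)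
      ((actN.flip (ν.symm n)).comp ((TensorProduct.lift (T.mul q)).comp (TensorProduct.map f g)))
  have g_symm : ∀ x, g ((T.α b).symm x) = (T.α q).symm (g x) := fun x => by
    rw [LinearEquiv.eq_symm_apply, ← hg, LinearEquiv.apply_symm_apply]
  have ν_symm : ∀ (x : H q) (y : N),
      ν.symm (actN x y) = actN ((T.α q).symm x) (ν.symm y) := fun x y => by
    rw [LinearEquiv.symm_apply_eq, hN.μ_act, LinearEquiv.apply_symm_apply,
      LinearEquiv.apply_symm_apply]
  have comp_eq : ∀ x : M ⊗[k] H b,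
      twistedAction μ ρM actN ν f
        (TensorProduct.map μ.toLinearMap (TensorProduct.lift (actN.comp g))
          (TensorProduct.assoc k M (H b) N (x ⊗ₜ ν.symm n)))
      = B (TensorProduct.assoc k M (H a) (H b)
          (TensorProduct.map (ρM a) (T.α b).symm.toLinearMap x)) := by
    intro x
    induction x with
    | zero => simp
    | add x y hx hy => simp only [TensorProduct.add_tmul, map_add, hx, hy]
    | tmul m' h =>
      have hρ : ρM a (μ m') = TensorProduct.map μ.toLinearMap (T.α a).toLinearMap (ρM a m') :=
        LinearMap.congr_fun (hM.ρ_μ a) m'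
      simp only [twistedAction, LinearMap.comp_apply, LinearEquiv.coe_coe,
        TensorProduct.assoc_tmul, TensorProduct.map_tmul, TensorProduct.lift.tmul, hρ]
      induction ρM a m' with
      | zero => simp
      | add x y hx hy => simp only [TensorProduct.add_tmul, map_add, hx, hy]
      | tmul m'' h' =>
        simp [B, hf, g_symm, ν_symm, hN.act_act]
  have counit_eq : ∀ y : M ⊗[k] H (1 : G),
      B (TensorProduct.map μ.symm.toLinearMap (T.comul a b)
        (TensorProduct.map LinearMap.id (cst k hab) y))
      = μ (TensorProduct.rid k M (TensorProduct.map LinearMap.id T.counit y)) ⊗ₜ n := by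
    intro y
    induction y with
    | zero => simp
    | add x y hx hy => simp only [TensorProduct.add_tmul, map_add, hx, hy]
    | tmul m' h =>
      simp [B, hfg, hN.act_one, TensorProduct.smul_tmul]
  have hco := LinearMap.congr_fun (hM.ρ_coassoc a b) m
  simp only [LinearMap.comp_apply, LinearEquiv.coe_coe] at hco
  calc _ = _ := comp_eq (ρM b m)
    _ = m ⊗ₜ n := by
      rw [← hco, coaction_cst ρM hab m, counit_eq, hM.ρ_counit, LinearEquiv.apply_symm_apply]

end TwistedAction

/-- The braiding `c_{M,N}` is bijective with inverse
`c⁻¹(ⁿ ⊗ m) = μ m₍₀₎ ⊗ m₍₁,q₎ ⬝ ν⁻¹ n`. -/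
theorem statement17 (T : HomTC k G H) (p q : G)
    (M : Type*) [AddCommGroup M] [Module k M] (N : Type*) [AddCommGroup N] [Module k N]
    (μ : M ≃ₗ[k] M) (actM : H p →ₗ[k] M →ₗ[k] M) (ρM : ∀ r : G, M →ₗ[k] M ⊗[k] H r)
    (ν : N ≃ₗ[k] N) (actN : H q →ₗ[k] N →ₗ[k] N) (ρN : ∀ r : G, N →ₗ[k] N ⊗[k] H r)
    (hM : IsYD k T p μ actM ρM) (hN : IsYD k T q ν actN ρN) :
    (braidInv k T q μ ρM actN ν).comp (braid k T q μ ρM actN ν) = LinearMap.id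
    ∧ (braid k T q μ ρM actN ν).comp (braidInv k T q μ ρM actN ν) = LinearMap.id
    ∧ Function.Bijective (braid k T q μ ρM actN ν) := by
  have hS : ∀ x, ((cst k (inv_inv q)).comp (T.antipode q⁻¹).toLinearMap) (T.α q⁻¹ x)
      = T.α q (((cst k (inv_inv q)).comp (T.antipode q⁻¹).toLinearMap) x) := fun x => by
    rw [LinearMap.comp_apply, T.ax.antipode_α, cst_comm_family T.α]
    rfl
  have right := twistedAction_comp T (show (1 : G) = q * q⁻¹ by group) hM hN LinearMap.id
    ((cst k (inv_inv q)).comp (T.antipode q⁻¹).toLinearMap) (fun _ => rfl) hS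
    (T.ax.antipode_right q)
  have left := twistedAction_comp T (show (1 : G) = q⁻¹ * q by group) hM hN
    ((cst k (inv_inv q)).comp (T.antipode q⁻¹).toLinearMap) LinearMap.id hS (fun _ => rfl)
    (T.ax.antipode_left q)
  have dc : (braidInv k T q μ ρM actN ν).comp (braid k T q μ ρM actN ν) = LinearMap.id := by
    rw [← right]
    ext m n
    simp [braid, braidInv, twistedAction]
  have cd : (braid k T q μ ρM actN ν).comp (braidInv k T q μ ρM actN ν) = LinearMap.id := by
    refine LinearMap.ext fun x => ?_
    have h := LinearMap.congr_fun left (TensorProduct.comm k N M x)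
    simpa [braid, braidInv, twistedAction] using congrArg (TensorProduct.comm k M N) h
  exact ⟨dc, cd, Function.bijective_iff_has_inverse.mpr
    ⟨braidInv k T q μ ρM actN ν,
    fun x => LinearMap.congr_fun dc x, fun x => LinearMap.congr_fun cd x⟩⟩
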